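/- Let 1 ≤ p < q < ∞ and set r = pq/(q−p). Let (Ω, 𝒜, μ) be a σ-finite measure space whose atomic part Ω_a is the disjoint union of an infinite sequence (A_n) of atoms with 0 < μ(A_n) < ∞, and let u : Ω → ℂ be measurable with u = 0 a.e. on the diffuse part Ω_d and u equal a.e. to a constant u(A_n) on each atom A_n, satisfying sup_n |u(A_n)|/μ(A_n)^{1/r} < ∞. Then the multiplication operator M_u : L^p(μ) → L^q(μ) is bounded and its essential norm equals limsup_{n→∞} |u(A_n)|/μ(A_n)^{1/r}. -/

import Mathlib

open MeasureTheory ENNReal Filter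

/-- The essential norm of a bounded linear operator: its distance to the compact operators. -/
noncomputable def essNorm {𝕜 X Y : Type*} [NontriviallyNormedField 𝕜]
    [NormedAddCommGroup X] [NormedSpace 𝕜 X] [NormedAddCommGroup Y] [NormedSpace 𝕜 Y]
    (T : X →L[𝕜] Y) : ℝ :=
  sInf ((fun K : X →L[𝕜] Y => ‖T - K‖) '' {K | IsCompactOperator ⇑K})

/-- `μ` is diffuse on `S`: any measurable subset of `S` of positive measure contains
measurable subsets of any smaller measure. -/
def IsDiffuseOn {Ω : Type*} [MeasurableSpace Ω] (μ : Measure Ω) (S : Set Ω) : Prop :=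
  ∀ A : Set Ω, MeasurableSet A → A ⊆ S → 0 < μ A →
    ∀ α : ℝ≥0∞, 0 < α → α < μ A → ∃ A' : Set Ω, MeasurableSet A' ∧ A' ⊆ A ∧ μ A' = α

/-- `A` is an atom of `μ`: a measurable set of positive measure, each of whose measurable
subsets has measure `0` or `μ A`. -/
def IsMeasAtom {Ω : Type*} [MeasurableSpace Ω] (μ : Measure Ω) (A : Set Ω) : Prop :=
  MeasurableSet A ∧ 0 < μ A ∧ ∀ B : Set Ω, MeasurableSet B → B ⊆ A → μ B = 0 ∨ μ B = μ A

/-- `μ` is purely atomic on `S`: `S` is a countable disjoint union of atoms of `μ`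
(some of which may be empty, to allow for finitely many atoms). -/
def IsPurelyAtomicOn {Ω : Type*} [MeasurableSpace Ω] (μ : Measure Ω) (S : Set Ω) : Prop :=
  ∃ A : ℕ → Set Ω, Pairwise (Function.onFun Disjoint A) ∧
    (∀ n, IsMeasAtom μ (A n) ∨ A n = ∅) ∧ S = ⋃ n, A n

/-- The measure space is separable: there is a sequence of measurable sets approximating
every measurable set arbitrarily well in measure of the symmetric difference. -/
def IsSeparableMeasure {Ω : Type*} [MeasurableSpace Ω] (μ : Measure Ω) : Prop :=
  ∃ B : ℕ → Set Ω, (∀ n, MeasurableSet (B n)) ∧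
    ∀ C : Set Ω, MeasurableSet C → ∀ ε : ℝ≥0∞, 0 < ε → ∃ n, μ (symmDiff C (B n)) < ε

section MeasAtom

variable {Ω : Type*} [MeasurableSpace Ω] {μ : Measure Ω}

/-- On an atom of finite measure, every measurable property holds almost everywhere or fails
almost everywhere. -/
lemma IsMeasAtom.ae_mem_or_ae_notMem {A : Set Ω} (hA : IsMeasAtom μ A) (hfin : μ A < ⊤)
    {U : Set Ω} (hU : MeasurableSet U) :
    (∀ᵐ x ∂μ.restrict A, x ∈ U) ∨ ∀ᵐ x ∂μ.restrict A, x ∉ U := by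
  have hAU : MeasurableSet (U ∩ A) := hU.inter hA.1
  rcases hA.2.2 (U ∩ A) hAU Set.inter_subset_right with h | h
  · right
    rw [ae_iff]
    simpa [Measure.restrict_apply hU] using h
  · left
    rw [ae_iff]
    change μ.restrict A Uᶜ = 0
    rw [measure_compl hU (by rw [Measure.restrict_apply hU, h]; exact hfin.ne)]
    simp [Measure.restrict_apply hU, h]

/-- On an atom of finite measure, a measurable function is bounded by its mean value. -/
lemma IsMeasAtom.ae_le_lintegral_div {A : Set Ω} (hA : IsMeasAtom μ A) (hfin : μ A < ⊤)
    {h : Ω → ℝ≥0∞} (hh : Measurable h) :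
    ∀ᵐ x ∂μ.restrict A, h x ≤ (∫⁻ x, h x ∂μ) / μ A := by
  have hpos := measure_le_setLAverage_pos hA.2.1.ne' hfin.ne (hh.aemeasurable (μ := μ.restrict A))
  have hU : MeasurableSet {x | h x ≤ ⨍⁻ a in A, h a ∂μ} := measurableSet_le hh measurable_const
  rcases hA.ae_mem_or_ae_notMem hfin hU with h1 | h1
  · filter_upwards [h1] with x hx
    refine le_trans hx ?_
    rw [setLAverage_eq]
    gcongr
    exact Measure.restrict_le_self
  · exfalso
    rw [ae_iff] at h1
    simp only [not_not] at h1
    change μ.restrict A {x | h x ≤ ⨍⁻ a in A, h a ∂μ} = 0 at h1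
    rw [Measure.restrict_apply hU] at h1
    refine hpos.ne' ?_
    convert h1 using 2
    ext x
    simp [and_comm]

/-- A measurable function is almost everywhere constant on an atom of finite measure. -/
lemma IsMeasAtom.exists_ae_eq_const {A : Set Ω} (hA : IsMeasAtom μ A) (hfin : μ A < ⊤)
    {f : Ω → ℂ} (hf : Measurable f) : ∃ a, ∀ᵐ x ∂μ.restrict A, f x = a :=
  exists_eventuallyEq_const_of_forall_separating MeasurableSet fun _ hU =>
    hA.ae_mem_or_ae_notMem hfin (hf hU)

end MeasAtom

section RpowEstimate

lemma ENNReal.mul_rpow_le_of_rpow_le_div {p q r : ℝ} (hp : 1 ≤ p) (hpq : p < q)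
    (hr : r = p * q / (q - p)) {a b x F m : ℝ≥0∞} (hm0 : m ≠ 0) (hm : m ≠ ⊤)
    (ha : a ≤ b * m ^ (1 / r)) (hx : x ^ p ≤ F / m) :
    (a * x) ^ q ≤ b ^ q * F ^ ((q - p) / p) * x ^ p := by
  have hp0 : 0 < p := by linarith
  have hq0 : 0 < q := by linarith
  have hs : 0 < (q - p) / p := div_pos (by linarith) hp0
  have hx1 : x ^ q = (x ^ p) ^ ((q - p) / p) * x ^ p := by
    rw [← ENNReal.rpow_mul, ← ENNReal.rpow_add_of_nonneg _ _ (by positivity) hp0.le]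
    congr 1
    field_simp
    ring
  have hm1 : (m ^ (1 / r)) ^ q = m ^ ((q - p) / p) := by
    rw [← ENNReal.rpow_mul]
    congr 1
    have : q - p ≠ 0 := by linarith
    rw [hr]
    field_simp
  have hms0 : m ^ ((q - p) / p) ≠ 0 := by simp [ENNReal.rpow_eq_zero_iff, hm0, hm]
  have hms : m ^ ((q - p) / p) ≠ ⊤ := ENNReal.rpow_ne_top_of_nonneg hs.le hm
  calc (a * x) ^ q = a ^ q * x ^ q := ENNReal.mul_rpow_of_nonneg _ _ hq0.le
    _ ≤ (b * m ^ (1 / r)) ^ q * ((F / m) ^ ((q - p) / p) * x ^ p) := by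
        rw [hx1]; gcongr
    _ = b ^ q * F ^ ((q - p) / p) * x ^ p * (m ^ ((q - p) / p) / m ^ ((q - p) / p)) := by
        rw [ENNReal.mul_rpow_of_nonneg _ _ hq0.le, hm1, ENNReal.div_rpow_of_nonneg _ _ hs.le,
          div_eq_mul_inv (F ^ _), div_eq_mul_inv (m ^ _)]
        ring
    _ = _ := by rw [ENNReal.div_self hms0 hms, mul_one]

end RpowEstimate

section MulOperator

variable {Ω : Type*} [MeasurableSpace Ω] {μ : Measure Ω} {A : ℕ → Set Ω} {p q r : ℝ}

lemma eLpNorm_mul_le_of_atoms (hA : ∀ n, IsMeasAtom μ (A n)) (hfin : ∀ n, μ (A n) < ⊤)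
    (hp : 1 ≤ p) (hpq : p < q) (hr : r = p * q / (q - p)) {v f : Ω → ℂ} {B : ℝ≥0∞}
    (hv : ∀ᵐ x ∂μ, v x = 0 ∨ ∃ n, x ∈ A n ∧ ‖v x‖ₑ ≤ B * μ (A n) ^ (1 / r))
    (hf : Measurable f) :
    eLpNorm (fun x => v x * f x) (ENNReal.ofReal q) μ
      ≤ B * eLpNorm f (ENNReal.ofReal p) μ := by
  have hp0 : 0 < p := by linarith
  have hq0 : 0 < q := by linarith
  have hs : 0 < (q - p) / p := div_pos (by linarith) hp0
  rw [eLpNorm_eq_lintegral_rpow_enorm_toReal (by simpa using hq0) (by simp),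
    eLpNorm_eq_lintegral_rpow_enorm_toReal (by simpa using hp0) (by simp),
    ENNReal.toReal_ofReal hp0.le, ENNReal.toReal_ofReal hq0.le]
  have hmeas : Measurable fun x => ‖f x‖ₑ ^ p := hf.enorm.pow_const p
  set F := ∫⁻ x, ‖f x‖ₑ ^ p ∂μ with hF
  have hatom : ∀ᵐ x ∂μ, ∀ n, x ∈ A n → ‖f x‖ₑ ^ p ≤ F / μ (A n) := by
    rw [ae_all_iff]
    intro n
    rw [← ae_restrict_iff' (hA n).1]
    exact (hA n).ae_le_lintegral_div (hfin n) hmeas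
  have hle : ∫⁻ x, ‖v x * f x‖ₑ ^ q ∂μ ≤ (B * F ^ (1 / p)) ^ q := by
    calc ∫⁻ x, ‖v x * f x‖ₑ ^ q ∂μ
        ≤ ∫⁻ x, B ^ q * F ^ ((q - p) / p) * ‖f x‖ₑ ^ p ∂μ := by
          refine lintegral_mono_ae ?_
          filter_upwards [hv, hatom] with x hx hfx
          rcases hx with h0 | ⟨n, hn, hb⟩
          · simp [h0, hq0]
          · rw [enorm_mul]
            exact ENNReal.mul_rpow_le_of_rpow_le_div hp hpq hr (hA n).2.1.ne' (hfin n).ne hb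
              (hfx n hn)
      _ = B ^ q * (F ^ ((q - p) / p) * F) := by
          rw [lintegral_const_mul _ hmeas, mul_assoc]
      _ = (B * F ^ (1 / p)) ^ q := by
          rw [ENNReal.mul_rpow_of_nonneg _ _ hq0.le, ← ENNReal.rpow_mul]
          congr 1
          nth_rw 2 [← ENNReal.rpow_one F]
          rw [← ENNReal.rpow_add_of_nonneg _ _ hs.le zero_le_one]
          congr 1
          field_simp
          ring
  calc (∫⁻ x, ‖v x * f x‖ₑ ^ q ∂μ) ^ (1 / q) ≤ ((B * F ^ (1 / p)) ^ q) ^ (1 / q) := by gcongr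
    _ = _ := by rw [← ENNReal.rpow_mul, mul_one_div_cancel hq0.ne', ENNReal.rpow_one]

variable [Fact ((1 : ℝ≥0∞) ≤ ENNReal.ofReal p)] [Fact ((1 : ℝ≥0∞) ≤ ENNReal.ofReal q)]

/-- `T` is the operator of multiplication by `v` between two `L^p` spaces. -/
def IsMulOperator (T : Lp ℂ (ENNReal.ofReal p) μ →L[ℂ] Lp ℂ (ENNReal.ofReal q) μ)
    (v : Ω → ℂ) : Prop :=
  ∀ f : Lp ℂ (ENNReal.ofReal p) μ, (T f : Ω → ℂ) =ᵐ[μ] fun x => v x * (f : Ω → ℂ) x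

lemma IsMulOperator.zero :
    IsMulOperator (0 : Lp ℂ (ENNReal.ofReal p) μ →L[ℂ] Lp ℂ (ENNReal.ofReal q) μ) 0 := by
  intro f
  filter_upwards [Lp.coeFn_zero ℂ (ENNReal.ofReal q) μ] with x hx
  simpa using hx

lemma IsMulOperator.add {S T : Lp ℂ (ENNReal.ofReal p) μ →L[ℂ] Lp ℂ (ENNReal.ofReal q) μ}
    {v w : Ω → ℂ} (hS : IsMulOperator S v) (hT : IsMulOperator T w) :
    IsMulOperator (S + T) (v + w) := by
  intro f
  filter_upwards [Lp.coeFn_add (S f) (T f), hS f, hT f] with x h1 h2 h3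
  rw [add_apply, h1, Pi.add_apply, Pi.add_apply, h2, h3, add_mul]

lemma IsMulOperator.sub {S T : Lp ℂ (ENNReal.ofReal p) μ →L[ℂ] Lp ℂ (ENNReal.ofReal q) μ}
    {v w : Ω → ℂ} (hS : IsMulOperator S v) (hT : IsMulOperator T w) :
    IsMulOperator (S - T) (v - w) := by
  intro f
  filter_upwards [Lp.coeFn_sub (S f) (T f), hS f, hT f] with x h1 h2 h3
  rw [sub_apply, h1, Pi.sub_apply, Pi.sub_apply, h2, h3, sub_mul]

lemma IsMulOperator.norm_le (hA : ∀ n, IsMeasAtom μ (A n)) (hfin : ∀ n, μ (A n) < ⊤)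
    (hp : 1 ≤ p) (hpq : p < q) (hr : r = p * q / (q - p)) {v : Ω → ℂ} {B : ℝ} (hB : 0 ≤ B)
    (hv : ∀ᵐ x ∂μ, v x = 0 ∨ ∃ n, x ∈ A n ∧ ‖v x‖ₑ ≤ ENNReal.ofReal B * μ (A n) ^ (1 / r))
    {T : Lp ℂ (ENNReal.ofReal p) μ →L[ℂ] Lp ℂ (ENNReal.ofReal q) μ} (hT : IsMulOperator T v) :
    ‖T‖ ≤ B := by
  refine T.opNorm_le_bound hB fun f => ?_
  have h := eLpNorm_mul_le_of_atoms hA hfin hp hpq hr hv (Lp.stronglyMeasurable f).measurable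
  rw [← eLpNorm_congr_ae (hT f)] at h
  rw [Lp.norm_def, Lp.norm_def]
  have h2 := ENNReal.toReal_mono (ENNReal.mul_ne_top ENNReal.ofReal_ne_top (Lp.eLpNorm_ne_top f)) h
  rwa [ENNReal.toReal_mul, ENNReal.toReal_ofReal hB] at h2

lemma exists_isMulOperator (hA : ∀ n, IsMeasAtom μ (A n)) (hfin : ∀ n, μ (A n) < ⊤)
    (hp : 1 ≤ p) (hpq : p < q) (hr : r = p * q / (q - p)) {v : Ω → ℂ} (hvm : Measurable v) {B : ℝ}
    (hB : 0 ≤ B)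
    (hv : ∀ᵐ x ∂μ, v x = 0 ∨ ∃ n, x ∈ A n ∧ ‖v x‖ₑ ≤ ENNReal.ofReal B * μ (A n) ^ (1 / r)) :
    ∃ T : Lp ℂ (ENNReal.ofReal p) μ →L[ℂ] Lp ℂ (ENNReal.ofReal q) μ, IsMulOperator T v := by
  have hle := fun f : Lp ℂ (ENNReal.ofReal p) μ =>
    eLpNorm_mul_le_of_atoms hA hfin hp hpq hr hv (Lp.stronglyMeasurable f).measurable
  have hmem : ∀ f : Lp ℂ (ENNReal.ofReal p) μ,
      MemLp (fun x => v x * (f : Ω → ℂ) x) (ENNReal.ofReal q) μ := fun f =>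
    ⟨(hvm.mul (Lp.stronglyMeasurable f).measurable).aestronglyMeasurable,
      (hle f).trans_lt
        (ENNReal.mul_lt_top ENNReal.ofReal_lt_top (Lp.eLpNorm_lt_top f))⟩
  let L : Lp ℂ (ENNReal.ofReal p) μ →ₗ[ℂ] Lp ℂ (ENNReal.ofReal q) μ :=
    { toFun := fun f => (hmem f).toLp _
      map_add' := fun f g => by
        ext1
        filter_upwards [(hmem (f + g)).coeFn_toLp, (hmem f).coeFn_toLp, (hmem g).coeFn_toLp,
          Lp.coeFn_add f g, Lp.coeFn_add ((hmem f).toLp _) ((hmem g).toLp _)] with x h1 h2 h3 h4 h5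
        rw [h1, h4, h5, Pi.add_apply, Pi.add_apply, h2, h3, mul_add]
      map_smul' := fun a f => by
        ext1
        filter_upwards [(hmem (a • f)).coeFn_toLp, (hmem f).coeFn_toLp,
          Lp.coeFn_smul a f, Lp.coeFn_smul a ((hmem f).toLp _)] with x h1 h2 h3 h4
        simp [h1, h2, h3, h4, mul_left_comm] }
  refine ⟨L.mkContinuous B fun f => ?_, fun f => (hmem f).coeFn_toLp⟩
  change ‖(hmem f).toLp _‖ ≤ _
  rw [Lp.norm_toLp, Lp.norm_def]
  have h2 := ENNReal.toReal_mono
    (ENNReal.mul_ne_top ENNReal.ofReal_ne_top (Lp.eLpNorm_ne_top f)) (hle f)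
  rwa [ENNReal.toReal_mul, ENNReal.toReal_ofReal hB] at h2

/-- Multiplication by a function supported on an atom is a compact operator. -/
lemma IsMulOperator.isCompactOperator_of_atom {E : Set Ω} (hE : IsMeasAtom μ E) (hfin : μ E < ⊤)
    {v : Ω → ℂ} (hv : Measurable v)
    {T : Lp ℂ (ENNReal.ofReal p) μ →L[ℂ] Lp ℂ (ENNReal.ofReal q) μ}
    (hT : IsMulOperator T (E.indicator v)) : IsCompactOperator T := by
  let e : Lp ℂ (ENNReal.ofReal q) μ := indicatorConstLp _ hE.1 hfin.ne 1
  have hmem : ∀ f, T f ∈ Submodule.span ℂ {e} := by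
    intro f
    obtain ⟨a, ha⟩ := hE.exists_ae_eq_const hfin (hv.mul (Lp.stronglyMeasurable f).measurable)
    rw [ae_restrict_iff' hE.1] at ha
    rw [Submodule.mem_span_singleton]
    refine ⟨a, ?_⟩
    ext1
    filter_upwards [hT f, ha, Lp.coeFn_smul a e,
      (indicatorConstLp_coeFn : (e : Ω → ℂ) =ᵐ[μ] _)] with x h1 h2 h3 h4
    rw [h1, h3, Pi.smul_apply, h4]
    by_cases hx : x ∈ E
    · simp [hx, ← h2 hx]
    · simp [hx]
  have hid : IsCompactOperator (T.codRestrict (Submodule.span ℂ {e}) hmem) :=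
    isCompactOperator_of_locallyCompactSpace_dom (T.codRestrict (Submodule.span ℂ {e}) hmem)
  exact hid.clm_comp (Submodule.span ℂ {e}).subtypeL

end MulOperator

section LowerBound

variable {Ω : Type*} [MeasurableSpace Ω] {μ : Measure Ω} {A : ℕ → Set Ω} {p q r : ℝ}

/-- The restrictions of an `L^q` function to disjoint sets tend to zero in norm. -/
lemma tendsto_eLpNorm_restrict_zero (hq0 : 0 < q) (hA : ∀ n, MeasurableSet (A n))
    (hAdisj : Pairwise (Function.onFun Disjoint A)) {g : Ω → ℂ}
    (hg : MemLp g (ENNReal.ofReal q) μ) :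
    Tendsto (fun n => eLpNorm g (ENNReal.ofReal q) (μ.restrict (A n))) atTop (nhds 0) := by
  have hlt := hg.2
  simp_rw [eLpNorm_eq_lintegral_rpow_enorm_toReal (ε := ℂ) (p := ENNReal.ofReal q)
    (by simpa using hq0) (by simp), ENNReal.toReal_ofReal hq0.le] at hlt ⊢
  have hfin : ∫⁻ x, ‖g x‖ₑ ^ q ∂μ ≠ ⊤ := by
    intro h
    rw [h, ENNReal.top_rpow_of_pos (by positivity)] at hlt
    exact lt_irrefl _ hlt
  have hsum : ∑' n, ∫⁻ x in A n, ‖g x‖ₑ ^ q ∂μ ≠ ⊤ := by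
    rw [← lintegral_iUnion hA hAdisj]
    exact ne_top_of_le_ne_top hfin (setLIntegral_le_lintegral _ _)
  have h := (ENNReal.tendsto_atTop_zero_of_tsum_ne_top hsum).ennrpow_const (1 / q)
  rwa [ENNReal.zero_rpow_of_pos (by positivity)] at h

/-- The restrictions to disjoint sets of the values of a compact operator on a bounded sequence
tend to zero in norm. -/
lemma eventually_eLpNorm_restrict_le_of_isCompactOperator {X : Type*} [NormedAddCommGroup X]
    [NormedSpace ℂ X] [Fact ((1 : ℝ≥0∞) ≤ ENNReal.ofReal q)]
    (hA : ∀ n, MeasurableSet (A n)) (hAdisj : Pairwise (Function.onFun Disjoint A))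
    (hq0 : 0 < q) {K : X →L[ℂ] Lp ℂ (ENNReal.ofReal q) μ} (hK : IsCompactOperator K)
    {e : ℕ → X} (he : ∀ n, ‖e n‖ ≤ 1) {ε : ℝ} (hε : 0 < ε) :
    ∀ᶠ n in atTop, eLpNorm (K (e n)) (ENNReal.ofReal q) (μ.restrict (A n)) ≤ ENNReal.ofReal ε := by
  obtain ⟨C, hC, hKC⟩ := hK.image_closedBall_subset_compact (f := K.toLinearMap) 1
  obtain ⟨t, ht, hCt⟩ := Metric.totallyBounded_iff.1 hC.totallyBounded (ε / 2) (half_pos hε)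
  have hev : ∀ᶠ n in atTop, ∀ g ∈ t,
      eLpNorm g (ENNReal.ofReal q) (μ.restrict (A n)) ≤ ENNReal.ofReal (ε / 2) := by
    rw [ht.eventually_all]
    intro g _
    exact (tendsto_eLpNorm_restrict_zero hq0 hA hAdisj (Lp.memLp g)).eventually_le_const
      (by simpa using hε)
  filter_upwards [hev] with n hn
  have hmem : K (e n) ∈ C := hKC ⟨e n, by simpa using he n, rfl⟩
  obtain ⟨g, hg, hdist⟩ := Set.mem_iUnion₂.1 (hCt hmem)
  have hdist' : eLpNorm ((K (e n) : Ω → ℂ) - (g : Ω → ℂ)) (ENNReal.ofReal q) (μ.restrict (A n))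
      ≤ ENNReal.ofReal (ε / 2) := by
    refine (eLpNorm_mono_measure _ Measure.restrict_le_self).trans ?_
    rw [← Lp.edist_def, edist_dist]
    exact ENNReal.ofReal_le_ofReal (Metric.mem_ball.1 hdist).le
  calc eLpNorm (K (e n)) (ENNReal.ofReal q) (μ.restrict (A n))
      = eLpNorm (((K (e n) : Ω → ℂ) - (g : Ω → ℂ)) + (g : Ω → ℂ)) (ENNReal.ofReal q) (μ.restrict (A n)) := by
        rw [sub_add_cancel]
    _ ≤ _ := eLpNorm_add_le
        ((Lp.aestronglyMeasurable _).sub (Lp.aestronglyMeasurable _)).restrict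
        (Lp.aestronglyMeasurable _).restrict Fact.out
    _ ≤ ENNReal.ofReal (ε / 2) + ENNReal.ofReal (ε / 2) := add_le_add hdist' (hn g hg)
    _ = ENNReal.ofReal ε := by
        rw [← ENNReal.ofReal_add (by positivity) (by positivity), add_halves]

/-- If `u = c n` on `A n`, the distance from multiplication by `u` to any compact operator
eventually dominates `‖c n‖ / μ (A n) ^ (1 / r)` up to `ε`. -/
lemma IsMulOperator.eventually_le_norm_sub_add [Fact ((1 : ℝ≥0∞) ≤ ENNReal.ofReal p)]
    [Fact ((1 : ℝ≥0∞) ≤ ENNReal.ofReal q)]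
    (hA : ∀ n, IsMeasAtom μ (A n)) (hfin : ∀ n, μ (A n) < ⊤)
    (hAdisj : Pairwise (Function.onFun Disjoint A))
    (hp : 1 ≤ p) (hpq : p < q) (hr : r = p * q / (q - p)) {u : Ω → ℂ} {c : ℕ → ℂ}
    (huc : ∀ n, ∀ᵐ x ∂μ.restrict (A n), u x = c n)
    {T K : Lp ℂ (ENNReal.ofReal p) μ →L[ℂ] Lp ℂ (ENNReal.ofReal q) μ}
    (hT : IsMulOperator T u) (hK : IsCompactOperator K) {ε : ℝ} (hε : 0 < ε) :
    ∀ᶠ n in atTop, ‖c n‖ / (μ (A n)).toReal ^ (1 / r) ≤ ‖T - K‖ + ε := by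
  have hp0 : 0 < p := by linarith
  have hq0 : 0 < q := by linarith
  have hm : ∀ n, 0 < (μ (A n)).toReal := fun n => ENNReal.toReal_pos (hA n).2.1.ne' (hfin n).ne
  set e : ℕ → Lp ℂ (ENNReal.ofReal p) μ := fun n =>
    indicatorConstLp _ (hA n).1 (hfin n).ne (((μ (A n)).toReal ^ (-(1 / p)) : ℝ) : ℂ) with he_def
  have he : ∀ n, ‖e n‖ ≤ 1 := by
    intro n
    rw [he_def]
    dsimp only
    rw [norm_indicatorConstLp (by simpa using hp0) (by simp), ENNReal.toReal_ofReal hp0.le,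
      Complex.norm_real, Real.norm_of_nonneg (Real.rpow_nonneg (hm n).le _), measureReal_def,
      ← Real.rpow_add (hm n), neg_add_cancel, Real.rpow_zero]
  filter_upwards [eventually_eLpNorm_restrict_le_of_isCompactOperator (fun n => (hA n).1) hAdisj
    hq0 hK he hε] with n hn
  have hTe : eLpNorm (T (e n)) (ENNReal.ofReal q) (μ.restrict (A n))
      = ENNReal.ofReal (‖c n‖ / (μ (A n)).toReal ^ (1 / r)) := by
    have hae : (T (e n) : Ω → ℂ) =ᵐ[μ.restrict (A n)]
        fun _ => c n * (((μ (A n)).toReal ^ (-(1 / p)) : ℝ) : ℂ) := by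
      filter_upwards [ae_restrict_of_ae (hT (e n)), huc n, ae_restrict_mem (hA n).1,
        ae_restrict_of_ae (indicatorConstLp_coeFn_mem : ∀ᵐ x ∂μ, x ∈ A n → e n x = _)]
        with x h1 h2 h3 h4
      rw [h1, h2, h4 h3]
    rw [eLpNorm_congr_ae hae, eLpNorm_const' _ (by simpa using hq0) (by simp),
      ENNReal.toReal_ofReal hq0.le, Measure.restrict_apply_univ, ← ofReal_norm,
      ← ENNReal.ofReal_toReal (hfin n).ne, ENNReal.ofReal_rpow_of_pos (hm n),
      ← ENNReal.ofReal_mul (norm_nonneg _), ENNReal.toReal_ofReal (hm n).le, norm_mul,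
      Complex.norm_real, Real.norm_of_nonneg (Real.rpow_nonneg (hm n).le _), mul_assoc,
      ← Real.rpow_add (hm n), div_eq_mul_inv ‖c n‖, ← Real.rpow_neg (hm n).le]
    congr 3
    have : q - p ≠ 0 := by linarith
    rw [hr]
    field_simp
    ring
  have hsub : eLpNorm ((T - K) (e n)) (ENNReal.ofReal q) (μ.restrict (A n))
      ≤ ENNReal.ofReal ‖T - K‖ := by
    refine (eLpNorm_mono_measure _ Measure.restrict_le_self).trans ?_
    rw [← Lp.enorm_def, ← ofReal_norm]
    exact ENNReal.ofReal_le_ofReal ((T - K).le_of_opNorm_le_of_le le_rfl (he n) |>.trans_eq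
      (mul_one _))
  have hsum : (T (e n) : Ω → ℂ) =ᵐ[μ.restrict (A n)]
      ((T - K) (e n) : Ω → ℂ) + (K (e n) : Ω → ℂ) := by
    refine ae_restrict_of_ae ?_
    have h := Lp.coeFn_add ((T - K) (e n)) (K (e n))
    rwa [sub_apply, sub_add_cancel, ← sub_apply] at h
  rw [← ENNReal.ofReal_le_ofReal_iff (by positivity), ← hTe, eLpNorm_congr_ae hsum,
    ENNReal.ofReal_add (norm_nonneg _) hε.le]
  exact (eLpNorm_add_le (Lp.aestronglyMeasurable _).restrict
    (Lp.aestronglyMeasurable _).restrict Fact.out).trans (add_le_add hsub hn)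

end LowerBound

/-- For `1 ≤ p < q < ∞` and `r = pq/(q−p)`, on a σ-finite measure space whose atomic part is
the disjoint union of an infinite sequence of atoms `Aₙ` of finite positive measure, if `u = 0`
a.e. on the diffuse part and `u = c n` a.e. on `Aₙ` with `supₙ |c n|/μ(Aₙ)^{1/r} < ∞`, then
`M_u : L^p(μ) → L^q(μ)` is bounded with essential norm `limsupₙ |c n|/μ(Aₙ)^{1/r}`. -/
theorem essNorm_mul_Lp_Lq_atomic {Ω : Type*} [MeasurableSpace Ω] (μ : Measure Ω) [SigmaFinite μ]
    (Ωd Ωa : Set Ω) (hΩd : MeasurableSet Ωd) (hΩa : MeasurableSet Ωa)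
    (hdisj : Disjoint Ωd Ωa) (hunion : Ωd ∪ Ωa = Set.univ)
    (hdiffuse : IsDiffuseOn μ Ωd)
    (A : ℕ → Set Ω) (hAdisj : Pairwise (Function.onFun Disjoint A))
    (hAatom : ∀ n, IsMeasAtom μ (A n)) (hAfin : ∀ n, μ (A n) < ⊤)
    (hAunion : Ωa = ⋃ n, A n)
    (p q r : ℝ) [Fact ((1:ℝ≥0∞) ≤ ENNReal.ofReal p)] [Fact ((1:ℝ≥0∞) ≤ ENNReal.ofReal q)]
    (hp : 1 ≤ p) (hpq : p < q) (hr : r = p * q / (q - p))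
    (u : Ω → ℂ) (hmeas : Measurable u) (c : ℕ → ℂ)
    (hud : ∀ᵐ x ∂(μ.restrict Ωd), u x = 0)
    (huc : ∀ n, ∀ᵐ x ∂(μ.restrict (A n)), u x = c n)
    (hbdd : BddAbove (Set.range fun n => ‖c n‖ / (μ (A n)).toReal ^ (1 / r))) :
    ∃ T : Lp ℂ (ENNReal.ofReal p) μ →L[ℂ] Lp ℂ (ENNReal.ofReal q) μ,
      (∀ f : Lp ℂ (ENNReal.ofReal p) μ,
        (T f : Ω → ℂ) =ᵐ[μ] fun x => u x * (f : Ω → ℂ) x) ∧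
      essNorm T = limsup (fun n => ‖c n‖ / (μ (A n)).toReal ^ (1 / r)) atTop := by
  have hm : ∀ n, 0 < (μ (A n)).toReal := fun n =>
    ENNReal.toReal_pos (hAatom n).2.1.ne' (hAfin n).ne
  have hle : ∀ n B, 0 ≤ B → ‖c n‖ / (μ (A n)).toReal ^ (1 / r) ≤ B →
      ‖c n‖ₑ ≤ ENNReal.ofReal B * μ (A n) ^ (1 / r) := by
    intro n B hB h
    rw [div_le_iff₀ (Real.rpow_pos_of_pos (hm n) _)] at h
    rw [← ENNReal.ofReal_toReal (hAfin n).ne, ENNReal.ofReal_rpow_of_pos (hm n), ← ofReal_norm,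
      ← ENNReal.ofReal_mul hB]
    exact ENNReal.ofReal_le_ofReal h
  have hae : ∀ᵐ x ∂μ, (x ∉ ⋃ n, A n) ∧ u x = 0 ∨ ∃ n, x ∈ A n ∧ u x = c n := by
    rw [ae_restrict_iff' hΩd] at hud
    have huc' : ∀ᵐ x ∂μ, ∀ n, x ∈ A n → u x = c n :=
      ae_all_iff.2 fun n => (ae_restrict_iff' (hAatom n).1).1 (huc n)
    filter_upwards [hud, huc'] with x h1 h2
    by_cases hx : x ∈ ⋃ n, A n
    · obtain ⟨n, hn⟩ := Set.mem_iUnion.1 hx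
      exact Or.inr ⟨n, hn, h2 n hn⟩
    · refine Or.inl ⟨hx, h1 ?_⟩
      have : x ∈ Ωd ∪ Ωa := hunion ▸ Set.mem_univ x
      exact this.resolve_right (hAunion ▸ hx)
  obtain ⟨B, hB⟩ := hbdd
  have hBn : ∀ n, ‖c n‖ / (μ (A n)).toReal ^ (1 / r) ≤ B := fun n => hB ⟨n, rfl⟩
  have hnn : ∀ n, 0 ≤ ‖c n‖ / (μ (A n)).toReal ^ (1 / r) := fun n => by positivity
  have hB0 : 0 ≤ B := (hnn 0).trans (hBn 0)
  have hbound : ∀ᵐ x ∂μ, u x = 0 ∨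
      ∃ n, x ∈ A n ∧ ‖u x‖ₑ ≤ ENNReal.ofReal B * μ (A n) ^ (1 / r) := by
    filter_upwards [hae] with x hx
    rcases hx with h | ⟨n, hn, h⟩
    · exact Or.inl h.2
    · exact Or.inr ⟨n, hn, h ▸ hle n B hB0 (hBn n)⟩
  obtain ⟨T, hT⟩ := exists_isMulOperator hAatom hAfin hp hpq hr hmeas hB0 hbound
  refine ⟨T, hT, le_antisymm ?_ ?_⟩
  · have hKi : ∀ i, ∃ K : Lp ℂ (ENNReal.ofReal p) μ →L[ℂ] Lp ℂ (ENNReal.ofReal q) μ,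
        IsMulOperator K ((A i).indicator u) := by
      intro i
      refine exists_isMulOperator hAatom hAfin hp hpq hr (hmeas.indicator (hAatom i).1) hB0 ?_
      filter_upwards [hbound] with x hx
      by_cases hxi : x ∈ A i
      · simpa [hxi] using hx
      · simp [hxi]
    choose K hK using hKi
    have hsum : ∀ N, IsMulOperator (∑ i ∈ Finset.range N, K i)
        (∑ i ∈ Finset.range N, (A i).indicator u) ∧
        IsCompactOperator ⇑(∑ i ∈ Finset.range N, K i) := by
      intro N
      induction N with
      | zero => exact ⟨by simpa using IsMulOperator.zero, by simpa using isCompactOperator_zero⟩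
      | succ N ih =>
        rw [Finset.sum_range_succ, Finset.sum_range_succ]
        exact ⟨ih.1.add (hK N),
          ih.2.add ((hK N).isCompactOperator_of_atom (hAatom N) (hAfin N) hmeas)⟩
    refine le_of_forall_gt_imp_ge_of_dense fun b hb => ?_
    have hev := eventually_lt_of_limsup_lt hb (isBoundedUnder_of ⟨B, hBn⟩)
    obtain ⟨N, hN⟩ := eventually_atTop.1 hev
    have hb0 : 0 ≤ b := (hnn N).trans (hN N le_rfl).le
    refine (csInf_le ⟨0, ?_⟩ (Set.mem_image_of_mem (fun K => ‖T - K‖)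
      (Set.mem_ofPred.2 (hsum N).2))).trans ((hT.sub (hsum N).1).norm_le hAatom hAfin hp hpq hr hb0 ?_)
    · rintro _ ⟨S, -, rfl⟩
      exact norm_nonneg _
    · filter_upwards [hae] with x hx
      rcases hx with ⟨h, h0⟩ | ⟨n, hn, h⟩
      · left
        have hx0 : ∀ i, (A i).indicator u x = 0 := fun i =>
          Set.indicator_of_notMem (fun hi => h (Set.mem_iUnion_of_mem i hi)) _
        simp [Finset.sum_apply, hx0, h0]
      · have hind : ∀ i, (A i).indicator u x = if i = n then u x else 0 := by
          intro i
          split_ifs with hi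
          · simp [hi, hn]
          · exact Set.indicator_of_notMem
              (fun hxi => Set.disjoint_left.1 (hAdisj hi) hxi hn) _
        rcases lt_or_ge n N with hnN | hnN
        · left
          simp [Finset.sum_apply, hind, hnN]
        · right
          refine ⟨n, hn, ?_⟩
          simpa [Finset.sum_apply, hind, hnN.not_gt, h] using hle n b hb0 (hN n hnN).le
  · refine le_csInf ⟨_, 0, isCompactOperator_zero, rfl⟩ ?_
    rintro _ ⟨K, hK, rfl⟩
    refine le_of_forall_pos_le_add fun ε hε => ?_
    exact limsup_le_of_le (isCoboundedUnder_le_of_le atTop hnn)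
      (hT.eventually_le_norm_sub_add hAatom hAfin hAdisj hp hpq hr huc hK hε)
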